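/- Let A and B be simple unital complex C*-algebras, φ : GL(A) → GL(B) a group isomorphism, and θ the induced map on idempotents. Suppose e, f ∈ Ĩ(A) are orthogonal nontrivial idempotents with e + f ≠ 1, and let (a_e, b_e), (a_f, b_f), (a_{e+f}, b_{e+f}) be coefficient maps for e, f, e + f respectively, with c_g = a_g · b_g⁻¹. Then: θ(e)θ(f) = 0 ⟺ (c_e = c_f and c_e = c_{e+f}); θ(1−e)θ(1−f) = 0 ⟺ (c_e = c_f and c_e = c_{e+f}⁻¹); θ(1−e)θ(f) = 0 ⟺ (c_e = c_f⁻¹ and c_e = c_{e+f}); θ(e)θ(1−f) = 0 ⟺ (c_e = c_f⁻¹ and c_e = c_{e+f}⁻¹), where all equalities of c's are equalities of functions on ℂ∖{0}. -/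

import Mathlib

noncomputable section

/-- The symmetry `1 - 2e` associated to an idempotent `e` is a unit (its own inverse). -/
def symUnit {A : Type*} [Ring A] {e : A} (he : IsIdempotentElem e) : Aˣ where
  val := 1 - 2 * e
  inv := 1 - 2 * e
  val_inv := by
    have h : e * e = e := he
    have expand : (1 - 2 * e) * (1 - 2 * e) = 1 - 4 * e + 4 * (e * e) := by noncomm_ring
    rw [expand, h]; noncomm_ring
  inv_val := by
    have h : e * e = e := he
    have expand : (1 - 2 * e) * (1 - 2 * e) = 1 - 4 * e + 4 * (e * e) := by noncomm_ring
    rw [expand, h]; noncomm_ring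

/-- The map `θ_φ` induced on idempotents by a map `φ` between the groups of invertible
elements, determined by `1 - 2 θ_φ(e) = φ(1 - 2e)`, i.e. `θ_φ(e) = (1 - φ(1 - 2e))/2`;
it is extended by `0` off the set of idempotents. -/
noncomputable def theta {A B : Type*} [Ring A] [Ring B] [Algebra ℂ B]
    (φ : Aˣ → Bˣ) (e : A) : B :=
  letI := Classical.propDecidable (IsIdempotentElem e)
  if h : IsIdempotentElem e then (2 : ℂ)⁻¹ • ((1 : B) - (φ (symUnit h) : B)) else 0

/-- `a` and `b` are coefficient maps for the idempotent `e` (w.r.t. `φ`):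
`φ(λe + 1 - e) = a(λ) θ(e) + b(λ) θ(1-e)` for all nonzero `λ`. -/
def IsCoeffMaps {A B : Type*} [Ring A] [Ring B] [Algebra ℂ A] [Algebra ℂ B]
    (φ : Aˣ → Bˣ) (e : A) (a b : ℂˣ →* ℂˣ) : Prop :=
  ∀ (lam : ℂˣ) (v : Aˣ), (v : A) = (lam : ℂ) • e + 1 - e →
    (φ v : B) = ((a lam : ℂˣ) : ℂ) • theta φ e + ((b lam : ℂˣ) : ℂ) • theta φ (1 - e)

/-- `c(λ) = a(λ) b(λ)⁻¹`, as an element of `ℂˣ`. -/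
def cOf (a b : ℂˣ →* ℂˣ) (lam : ℂˣ) : ℂˣ := a lam * (b lam)⁻¹

variable {A B : Type*}
  [NormedRing A] [StarRing A] [CStarRing A] [CompleteSpace A]
  [NormedAlgebra ℂ A] [StarModule ℂ A]
  [NormedRing B] [StarRing B] [CStarRing B] [CompleteSpace B]
  [NormedAlgebra ℂ B] [StarModule ℂ B]

section Corners

variable {R : Type*} [Ring R] [Algebra ℂ R]

/-- Comparing coefficients on the corner `E * F` of two commuting idempotents. -/
lemma corner_coeff {E F : R} (hE : E * E = E) (hF : F * F = F) (hEF : E * F = F * E)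
    {a b a' b' a'' b'' : ℂ}
    (h : a'' • (E * (1 - F) + (1 - E) * F) + b'' • (E * F + (1 - E) * (1 - F)) =
      (a • E + b • (1 - E)) * (a' • F + b' • (1 - F)))
    (h0 : E * F ≠ 0) : b'' = a * a' := by
  obtain ⟨P, hP⟩ : ∃ P, P = E * F := ⟨_, rfl⟩
  have hPE : P * E = P := by rw [hP, mul_assoc, ← hEF, ← mul_assoc, hE]
  have hPF : P * F = P := by rw [hP, mul_assoc, hF]
  have h1 := congrArg (P * ·) h
  simp only [mul_add, mul_sub, mul_one, ← mul_assoc, mul_smul_comm, hPE, hPF, sub_self,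
    smul_zero, add_zero, zero_add, smul_mul_assoc, zero_mul, smul_smul] at h1
  refine smul_left_injective ℂ (hP ▸ h0 : P ≠ 0) ?_
  simpa [mul_comm] using h1

lemma mul_eq_zero_iff_cOf_eq {E F : R} (hE : E * E = E) (hF : F * F = F) (hEF : E * F = F * E)
    (hE0 : E ≠ 0) (hF0 : F ≠ 0) (hne : E ≠ F) (hadd : E + F ≠ 1)
    (a b a' b' a'' b'' : ℂˣ →* ℂˣ)
    (h : ∀ x : ℂˣ, (a'' x : ℂ) • (E * (1 - F) + (1 - E) * F) +
        (b'' x : ℂ) • (E * F + (1 - E) * (1 - F)) =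
      ((a x : ℂ) • E + (b x : ℂ) • (1 - E)) * ((a' x : ℂ) • F + (b' x : ℂ) • (1 - F)))
    (hc : ∃ x, cOf a b x ≠ (cOf a b x)⁻¹) :
    E * F = 0 ↔ (∀ x, cOf a b x = cOf a' b' x) ∧ (∀ x, cOf a b x = cOf a'' b'' x) := by
  have hE' : (1 - E) * (1 - E) = 1 - E := by simp [mul_sub, sub_mul, hE]
  have hF' : (1 - F) * (1 - F) = 1 - F := by simp [mul_sub, sub_mul, hF]
  have c00 : E * F ≠ 0 → ∀ x, b'' x = a x * a' x := fun h0 x ↦ by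
    ext; exact corner_coeff hE hF hEF (h x) h0
  have c01 : E * (1 - F) ≠ 0 → ∀ x, a'' x = a x * b' x := fun h0 x ↦ by
    ext
    refine corner_coeff (b := b x) (a' := b' x) (b' := a' x) (a'' := b'' x) hE hF'
      (by simp [mul_sub, sub_mul, hEF]) ?_ h0
    rw [sub_sub_cancel, add_comm, h x, add_comm ((b' x : ℂ) • _)]
  have c10 : (1 - E) * F ≠ 0 → ∀ x, a'' x = b x * a' x := fun h0 x ↦ by
    ext
    refine corner_coeff (b := a x) (a' := a' x) (b' := b' x) (a'' := b'' x) hE' hF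
      (by simp [mul_sub, sub_mul, hEF]) ?_ h0
    rw [sub_sub_cancel, add_comm, add_comm ((1 - E) * F), add_comm ((1 - E) * (1 - F)), h x,
      add_comm ((b x : ℂ) • _)]
  have c11 : (1 - E) * (1 - F) ≠ 0 → ∀ x, b'' x = b x * b' x := fun h0 x ↦ by
    ext
    refine corner_coeff (b := a x) (a' := b' x) (b' := a' x) (a'' := a'' x) hE' hF'
      (by simp [mul_sub, sub_mul, hEF]; abel) ?_ h0
    rw [sub_sub_cancel, sub_sub_cancel, add_comm ((1 - E) * F), add_comm ((1 - E) * (1 - F)), h x,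
      add_comm ((b x : ℂ) • _), add_comm ((b' x : ℂ) • _)]
  constructor
  · intro h0
    have h01 := c01 (by simpa [mul_sub, h0] using hE0)
    have h10 := c10 (by simpa [sub_mul, h0] using hF0)
    have h11 := c11 (by
      rw [show (1 - E) * (1 - F) = 1 - (E + F) + E * F by noncomm_ring, h0, add_zero]
      exact sub_ne_zero.2 hadd.symm)
    refine ⟨fun x ↦ ?_, fun x ↦ ?_⟩
    · have := (h01 x).symm.trans (h10 x)
      simp only [cOf, ← div_eq_mul_inv]
      rw [div_eq_div_iff_mul_eq_mul, this, mul_comm]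
    · rw [cOf, cOf, h01, h11, ← div_eq_mul_inv, ← div_eq_mul_inv, mul_div_mul_right_eq_div]
  · rintro ⟨h1, h2⟩
    obtain ⟨x, hx⟩ := hc
    by_contra h0
    have h00 := c00 h0 x
    by_cases e01 : E * (1 - F) = 0
    · by_cases e10 : (1 - E) * F = 0
      · rw [mul_sub, mul_one, sub_eq_zero] at e01
        rw [sub_mul, one_mul, sub_eq_zero] at e10
        exact hne (e01.trans e10.symm)
      · refine hx ?_
        conv_lhs => rw [h2 x]
        rw [cOf, cOf, c10 e10 x, h00, ← div_eq_mul_inv, ← div_eq_mul_inv,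
          mul_div_mul_right_eq_div, inv_div]
    · refine hx ?_
      conv_lhs => rw [h2 x]
      rw [h1 x, cOf, cOf, c01 e01 x, h00, ← div_eq_mul_inv, ← div_eq_mul_inv,
        mul_div_mul_left_eq_div, inv_div]

end Corners

lemma cOf_swap (a b : ℂˣ →* ℂˣ) (x : ℂˣ) : cOf b a x = (cOf a b x)⁻¹ := by
  simp [cOf]

lemma two_theta {R S : Type*} [Ring R] [Ring S] [Algebra ℂ S] {ψ : Rˣ → Sˣ} {p : R} (hp : IsIdempotentElem p) :
    1 - 2 * theta ψ p = ψ (symUnit hp) := by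
  have h2 : (2 : S) = algebraMap ℂ S 2 := (map_ofNat _ 2).symm
  rw [theta, dif_pos hp, h2, ← Algebra.smul_def, smul_smul]
  simp

/-- A central square root of `1` in a simple ring is `1` or `-1`. -/
lemma eq_one_or_eq_neg_one_of_central {S : Type*} [Ring S] [IsSimpleRing S] {s : S} (hs : s * s = 1)
    (hc : ∀ x, s * x = x * s) : s = 1 ∨ s = -1 := by
  have hz : (1 - s) * (1 + s) = 0 := by
    rw [show (1 - s) * (1 + s) = 1 - s * s by noncomm_ring, hs, sub_self]
  by_contra! hne
  have hfield := IsSimpleRing.isField_center S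
  let u : Subring.center S := ⟨s, Subring.mem_center_iff.2 fun x ↦ (hc x).symm⟩
  have hu : (1 - u) * (1 + u) = 0 := Subtype.ext hz
  let := hfield.toField
  rcases mul_eq_zero.1 hu with h | h
  · exact hne.1 (sub_eq_zero.1 (congrArg Subtype.val h)).symm
  · exact hne.2 (eq_neg_of_add_eq_zero_right (congrArg Subtype.val h))

/-- An element commuting with all units of a complex Banach algebra is central. -/
lemma commute_of_commute_units {S : Type*} [NormedRing S] [NormedAlgebra ℂ S] [CompleteSpace S]
    {s : S} (h : ∀ u : Sˣ, s * u = u * s) (x : S) : s * x = x * s := by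
  obtain ⟨z, hz⟩ : ∃ z : ℂ, ‖x‖ * ‖(1 : S)‖ < ‖z‖ :=
    ⟨((‖x‖ * ‖(1 : S)‖ + 1 : ℝ) : ℂ), by
      rw [Complex.norm_real, Real.norm_of_nonneg (by positivity)]; linarith⟩
  obtain ⟨u, hu⟩ := spectrum.mem_resolventSet_of_norm_lt_mul hz
  have h1 := h u
  rw [hu, mul_sub, sub_mul, Algebra.commutes z s] at h1
  simpa using h1

lemma map_neg_one_units {R S : Type*} [Ring R] [Algebra ℂ R] [Nontrivial R]
    [NormedRing S] [NormedAlgebra ℂ S] [CompleteSpace S] [IsSimpleRing S] (φ : Rˣ ≃* Sˣ) :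
    φ (-1) = -1 := by
  have hsq : φ (-1) * φ (-1) = 1 := by rw [← map_mul]; simp
  have hcomm : ∀ u : Sˣ, (φ (-1) : S) * u = u * φ (-1) := fun u ↦ by
    obtain ⟨v, rfl⟩ := φ.surjective u
    rw [← Units.val_mul, ← Units.val_mul, ← map_mul, ← map_mul]
    simp
  rcases eq_one_or_eq_neg_one_of_central (by simpa using congrArg Units.val hsq)
    (commute_of_commute_units hcomm) with h | h
  · have h1 : φ (-1) = φ 1 := by rw [map_one]; exact Units.ext h
    have h2 : (-1 : R) = 1 := congrArg Units.val (φ.injective h1)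
    have h3 : (2 : ℂ) • (1 : R) = 0 := by
      rw [two_smul]; nth_rewrite 1 [← h2]; simp
    simp at h3
  · exact Units.ext h

section ThetaProperties

variable {R S : Type*} [Ring R] [Ring S] [Algebra ℂ S]

lemma two_mul_cancel {x y : S} (h : 1 - 2 * x = 1 - 2 * y) : x = y := by
  have h1 : (2 : ℂ) • x = (2 : ℂ) • y := by
    rw [two_smul, two_smul, ← two_mul, ← two_mul]; exact sub_right_injective h
  exact smul_right_injective S (two_ne_zero' ℂ) h1

lemma isIdempotentElem_theta (φ : Rˣ ≃* Sˣ) {p : R} (hp : IsIdempotentElem p) :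
    theta φ p * theta φ p = theta φ p := by
  have h1 : symUnit hp * symUnit hp = 1 := Units.ext (symUnit hp).mul_inv
  have h2 : (φ (symUnit hp) : S) * φ (symUnit hp) = 1 := by
    rw [← Units.val_mul, ← map_mul, h1]; simp
  rw [← two_theta] at h2
  generalize theta φ p = E at h2 ⊢
  have h3 : (4 : ℂ) • (E * E - E) = 0 := by
    rw [← sub_eq_zero] at h2
    rw [← h2, Algebra.smul_def, map_ofNat]; noncomm_ring
  exact sub_eq_zero.1 ((smul_eq_zero.1 h3).resolve_left (by norm_num))

lemma theta_zero (φ : Rˣ ≃* Sˣ) : theta φ 0 = 0 := by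
  have h : symUnit (IsIdempotentElem.zero (M₀ := R)) = 1 := by ext; simp [symUnit]
  rw [theta, dif_pos IsIdempotentElem.zero, h]; simp

lemma theta_one_sub (φ : Rˣ ≃* Sˣ) (hφ : φ (-1) = -1) {p : R} (hp : IsIdempotentElem p) :
    theta φ (1 - p) = 1 - theta φ p := by
  apply two_mul_cancel
  have h : symUnit hp.one_sub = -1 * symUnit hp := by
    ext; simp only [symUnit, Units.val_mul, Units.val_neg, Units.val_one]; noncomm_ring
  rw [two_theta hp.one_sub, h, map_mul, hφ]
  simp only [Units.val_mul, Units.val_neg, Units.val_one, ← two_theta]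
  noncomm_ring

lemma theta_commute (φ : Rˣ ≃* Sˣ) {p q : R} (hp : IsIdempotentElem p)
    (hq : IsIdempotentElem q) (hpq : p * q = q * p) :
    theta φ p * theta φ q = theta φ q * theta φ p := by
  have h : symUnit hp * symUnit hq = symUnit hq * symUnit hp := by
    ext
    simp only [symUnit, Units.val_mul, two_mul, mul_sub, sub_mul, mul_add, add_mul, hpq, one_mul,
      mul_one]
    abel
  have h1 : (φ (symUnit hp) : S) * φ (symUnit hq) = φ (symUnit hq) * φ (symUnit hp) := by
    rw [← Units.val_mul, ← Units.val_mul, ← map_mul, ← map_mul, h]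
  rw [← two_theta, ← two_theta] at h1
  generalize theta φ p = E at h1 ⊢
  generalize theta φ q = F at h1 ⊢
  have h3 : (4 : ℂ) • (E * F - F * E) = 0 := by
    rw [← sub_eq_zero] at h1
    rw [← h1, Algebra.smul_def, map_ofNat]; noncomm_ring
  exact sub_eq_zero.1 ((smul_eq_zero.1 h3).resolve_left (by norm_num))

lemma theta_add (φ : Rˣ ≃* Sˣ) {p q : R} (hp : IsIdempotentElem p)
    (hq : IsIdempotentElem q) (hpq : p * q = 0) (hs : IsIdempotentElem (p + q)) :
    theta φ (p + q) = theta φ p + theta φ q - 2 * (theta φ p * theta φ q) := by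
  have h : symUnit hs = symUnit hp * symUnit hq := by
    ext
    simp only [symUnit, Units.val_mul, two_mul, mul_sub, sub_mul, mul_add, add_mul, hpq, one_mul,
      mul_one]
    abel
  apply two_mul_cancel
  rw [two_theta hs, h, map_mul, Units.val_mul, ← two_theta, ← two_theta]
  noncomm_ring

variable [Algebra ℂ R]

lemma theta_injective (φ : Rˣ ≃* Sˣ) {p q : R} (hp : IsIdempotentElem p)
    (hq : IsIdempotentElem q) (h : theta φ p = theta φ q) : p = q := by
  have h1 : φ (symUnit hp) = φ (symUnit hq) := by
    ext; rw [← two_theta, ← two_theta, h]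
  exact two_mul_cancel (congrArg Units.val (φ.injective h1))

/-- The unit `λ p + 1 - p`. -/
def scaleUnit {p : R} (hp : IsIdempotentElem p) (x : ℂˣ) : Rˣ where
  val := (x : ℂ) • p + 1 - p
  inv := ((x⁻¹ : ℂˣ) : ℂ) • p + 1 - p
  val_inv := by
    simp [mul_sub, sub_mul, mul_add, add_mul, hp.eq, smul_smul]
  inv_val := by
    simp [mul_sub, sub_mul, mul_add, add_mul, hp.eq, smul_smul]

/-- Coefficient maps at `i` satisfy `c(i) ≠ c(i)⁻¹`, since `c(-1) = -1`. -/
lemma exists_cOf_ne_inv (φ : Rˣ ≃* Sˣ) (hφ : φ (-1) = -1) {p : R} (hp : IsIdempotentElem p)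
    (hp0 : theta φ p ≠ 0) (hp1 : theta φ p ≠ 1) {a b : ℂˣ →* ℂˣ} (h : IsCoeffMaps φ p a b) :
    ∃ x, cOf a b x ≠ (cOf a b x)⁻¹ := by
  have hE := isIdempotentElem_theta φ hp
  have h1 := h (-1) (symUnit hp) (by simp [symUnit, two_mul]; abel)
  rw [← two_theta, theta_one_sub φ hφ hp] at h1
  have hp1' : 1 - theta φ p ≠ 0 := sub_ne_zero.2 hp1.symm
  generalize theta φ p = E at *
  have ha : (a (-1) : ℂ) = -1 := by
    have := congrArg (E * ·) h1
    simp only [mul_add, mul_sub, mul_smul_comm, two_mul, hE, mul_one, sub_self, smul_zero,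
      add_zero] at this
    refine smul_left_injective ℂ hp0 ?_
    simp only [← this]; simp
  have hb : (b (-1) : ℂ) = 1 := by
    have := congrArg ((1 - E) * ·) h1
    simp only [mul_add, mul_sub, sub_mul, mul_smul_comm, two_mul, hE, mul_one, sub_self, smul_zero,
      one_mul, zero_add, add_zero, sub_zero] at this
    refine smul_left_injective ℂ hp1' ?_
    simp only [← this]; simp
  refine ⟨Units.mk0 Complex.I Complex.I_ne_zero, fun hx ↦ ?_⟩
  have hI : Units.mk0 Complex.I Complex.I_ne_zero * Units.mk0 Complex.I Complex.I_ne_zero = -1 := by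
    ext; simp
  have h2 : cOf a b (-1) = 1 := by
    rw [← hI]
    conv_rhs => rw [← mul_inv_cancel (cOf a b (Units.mk0 Complex.I Complex.I_ne_zero)), ← hx]
    simp only [cOf, map_mul, mul_inv]
    exact mul_mul_mul_comm _ _ _ _
  have h3 := congrArg Units.val h2
  simp only [cOf, Units.val_mul, Units.val_inv_eq_inv_val, ha, hb, Units.val_one] at h3
  norm_num at h3

lemma coeffMaps_add (φ : Rˣ ≃* Sˣ) (hφ : φ (-1) = -1) {p q : R} (hp : IsIdempotentElem p)
    (hq : IsIdempotentElem q) (hpq : p * q = 0) (hs : IsIdempotentElem (p + q))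
    {a b a' b' a'' b'' : ℂˣ →* ℂˣ} (h : IsCoeffMaps φ p a b) (h' : IsCoeffMaps φ q a' b')
    (h'' : IsCoeffMaps φ (p + q) a'' b'') (x : ℂˣ) :
    (a'' x : ℂ) • (theta φ p * (1 - theta φ q) + (1 - theta φ p) * theta φ q) +
        (b'' x : ℂ) • (theta φ p * theta φ q + (1 - theta φ p) * (1 - theta φ q)) =
      ((a x : ℂ) • theta φ p + (b x : ℂ) • (1 - theta φ p)) *
        ((a' x : ℂ) • theta φ q + (b' x : ℂ) • (1 - theta φ q)) := by
  have hmul : scaleUnit hs x = scaleUnit hp x * scaleUnit hq x := by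
    ext
    simp only [scaleUnit, Units.val_mul, mul_sub, sub_mul, mul_add, add_mul, hpq, smul_mul_assoc,
      mul_smul_comm, smul_zero, smul_add, one_mul, mul_one]
    abel
  have h1 : (φ (scaleUnit hs x) : S) = φ (scaleUnit hp x) * φ (scaleUnit hq x) := by
    rw [hmul, map_mul, Units.val_mul]
  rw [h x (scaleUnit hp x) rfl, h' x (scaleUnit hq x) rfl, h'' x (scaleUnit hs x) rfl, theta_one_sub φ hφ hp, theta_one_sub φ hφ hq,
    theta_one_sub φ hφ hs, theta_add φ hp hq hpq hs] at h1
  rw [← h1]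
  congr 2 <;> simp only [two_mul, mul_sub, sub_mul, mul_one, one_mul] <;> abel

end ThetaProperties

theorem statement8 [IsSimpleRing A] [IsSimpleRing B] (φ : Aˣ ≃* Bˣ)
    (e f : A) (he : IsIdempotentElem e) (he0 : e ≠ 0) (he1 : e ≠ 1)
    (hf : IsIdempotentElem f) (hf0 : f ≠ 0) (hf1 : f ≠ 1)
    (hef : e * f = 0) (hfe : f * e = 0) (hone : e + f ≠ 1)
    (ae be af bf aef bef : ℂˣ →* ℂˣ)
    (hce : IsCoeffMaps (⇑φ) e ae be) (hcf : IsCoeffMaps (⇑φ) f af bf)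
    (hcef : IsCoeffMaps (⇑φ) (e + f) aef bef) :
    (theta (⇑φ) e * theta (⇑φ) f = 0 ↔
      ((∀ lam : ℂˣ, cOf ae be lam = cOf af bf lam) ∧
       (∀ lam : ℂˣ, cOf ae be lam = cOf aef bef lam))) ∧
    (theta (⇑φ) (1 - e) * theta (⇑φ) (1 - f) = 0 ↔
      ((∀ lam : ℂˣ, cOf ae be lam = cOf af bf lam) ∧
       (∀ lam : ℂˣ, cOf ae be lam = (cOf aef bef lam)⁻¹))) ∧
    (theta (⇑φ) (1 - e) * theta (⇑φ) f = 0 ↔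
      ((∀ lam : ℂˣ, cOf ae be lam = (cOf af bf lam)⁻¹) ∧
       (∀ lam : ℂˣ, cOf ae be lam = cOf aef bef lam))) ∧
    (theta (⇑φ) e * theta (⇑φ) (1 - f) = 0 ↔
      ((∀ lam : ℂˣ, cOf ae be lam = (cOf af bf lam)⁻¹) ∧
       (∀ lam : ℂˣ, cOf ae be lam = (cOf aef bef lam)⁻¹))) := by
  have hs : IsIdempotentElem (e + f) := by
    simp [IsIdempotentElem, mul_add, add_mul, he.eq, hf.eq, hef, hfe]
  have hφ := map_neg_one_units φ
  have key := coeffMaps_add φ hφ he hf hef hs hce hcf hcef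
  have t1 : theta φ (1 : A) = 1 := by
    simpa [theta_zero] using theta_one_sub φ hφ (IsIdempotentElem.zero (M₀ := A))
  have hE0 : theta φ e ≠ 0 := fun h ↦
    he0 (theta_injective φ he .zero (h.trans (theta_zero φ).symm))
  have hE1 : theta φ e ≠ 1 := fun h ↦ he1 (theta_injective φ he .one (h.trans t1.symm))
  have hF0 : theta φ f ≠ 0 := fun h ↦
    hf0 (theta_injective φ hf .zero (h.trans (theta_zero φ).symm))
  have hF1 : theta φ f ≠ 1 := fun h ↦ hf1 (theta_injective φ hf .one (h.trans t1.symm))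
  have hne : theta φ e ≠ theta φ f := fun h ↦ by
    have := theta_injective φ he hf h
    rw [← this, he.eq] at hef
    exact he0 hef
  have hadd : theta φ e + theta φ f ≠ 1 := fun h ↦
    hone (eq_sub_iff_add_eq.1 (theta_injective φ he hf.one_sub
      ((eq_sub_of_add_eq h).trans (theta_one_sub φ hφ hf).symm)))
  have hc := exists_cOf_ne_inv φ hφ he hE0 hE1 hce
  have hc' : ∃ x, cOf be ae x ≠ (cOf be ae x)⁻¹ := by
    obtain ⟨x, hx⟩ := hc
    exact ⟨x, by rw [cOf_swap ae be, inv_inv]; exact hx.symm⟩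
  have hEE := isIdempotentElem_theta φ he
  have hFF := isIdempotentElem_theta φ hf
  have hEF := theta_commute φ he hf (hef.trans hfe.symm)
  rw [theta_one_sub φ hφ he, theta_one_sub φ hφ hf]
  generalize theta φ e = E at *
  generalize theta φ f = F at *
  have hEE' : (1 - E) * (1 - E) = 1 - E := by simp [mul_sub, sub_mul, hEE]
  have hFF' : (1 - F) * (1 - F) = 1 - F := by simp [mul_sub, sub_mul, hFF]
  have hE1' : 1 - E ≠ 0 := sub_ne_zero.2 hE1.symm
  have hF1' : 1 - F ≠ 0 := sub_ne_zero.2 hF1.symm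
  refine ⟨mul_eq_zero_iff_cOf_eq hEE hFF hEF hE0 hF0 hne hadd ae be af bf aef bef key hc,
    (mul_eq_zero_iff_cOf_eq hEE' hFF' ?_ hE1' hF1' ?_ ?_ be ae bf af aef bef ?_ hc').trans ?_,
    (mul_eq_zero_iff_cOf_eq hEE' hFF ?_ hE1' hF0 ?_ ?_ be ae af bf bef aef ?_ hc').trans ?_,
    (mul_eq_zero_iff_cOf_eq hEE hFF' ?_ hE0 hF1' ?_ ?_ ae be bf af bef aef ?_ hc).trans ?_⟩
  · simp only [mul_sub, sub_mul, hEF, mul_one, one_mul]; abel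
  · simpa using hne
  · intro h
    refine hadd ?_
    rw [show E + F = 1 + 1 - ((1 - E) + (1 - F)) by abel, h, add_sub_cancel_right]
  · intro x
    rw [sub_sub_cancel, sub_sub_cancel, add_comm ((1 - E) * F), add_comm ((1 - E) * (1 - F)),
      key x, add_comm ((be x : ℂ) • _), add_comm ((bf x : ℂ) • _)]
  · simp only [cOf_swap ae be, cOf_swap af bf, inv_eq_iff_eq_inv, inv_inv]
  · simp only [mul_sub, sub_mul, hEF, mul_one, one_mul]
  · intro h
    exact hadd (by rw [← h]; abel)
  · intro h
    exact hne (by rw [sub_add_eq_add_sub, sub_eq_iff_eq_add, add_right_inj] at h; exact h.symm)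
  · intro x
    rw [sub_sub_cancel, add_comm, add_comm ((1 - E) * F), add_comm ((1 - E) * (1 - F)), key x,
      add_comm ((be x : ℂ) • _)]
  · simp only [cOf_swap ae be, cOf_swap aef bef, inv_eq_iff_eq_inv, inv_inv]
  · simp only [mul_sub, sub_mul, hEF, mul_one, one_mul]
  · intro h
    exact hadd (by rw [h]; abel)
  · intro h
    exact hne (by rw [add_sub_left_comm, add_eq_left, sub_eq_zero] at h; exact h)
  · intro x
    rw [sub_sub_cancel, add_comm, key x, add_comm ((bf x : ℂ) • _)]
  · simp only [cOf_swap af bf, cOf_swap aef bef]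

end
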